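/- arXiv:2001.11763 — 2 statements merged into one kernel-verified Lean document; each statement's English description precedes it below -/
import Mathlib

section
/- If w is a square-free walk in the digraph D̂ (a walk regarded as a word over the vertex set V(D̂) in which consecutive letters are joined by an arc of D̂), then every word in the set δ(w) is square-free. -/
/-- A word `w` is square-free if it contains no factor `x ++ x` with `x` nonempty. -/
def SquareFree {α : Type*} (w : List α) : Prop :=
  ∀ x : List α, x ≠ [] → ¬ (x ++ x) <:+: w

/-- `v` is an extension of `w`: insert a single letter anywhere in `w`. -/
def IsExtension {α : Type*} (w v : List α) : Prop :=
  ∃ (w' w'' : List α) (a : α), w = w' ++ w'' ∧ v = w' ++ [a] ++ w''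

/-- `w` is extremal square-free. -/
def ExtremalSquareFree {α : Type*} (w : List α) : Prop :=
  SquareFree w ∧ ∀ v, IsExtension w v → ¬ SquareFree v

/-- Extension of a set-valued substitution from letters to words:
`SubstSet f (a₁ ⋯ aₙ) = {A₁ ++ ⋯ ++ Aₙ : Aᵢ ∈ f aᵢ}`. -/
def SubstSet {α β : Type*} (f : α → Set (List β)) : List α → Set (List β)
  | [] => {[]}
  | a :: w => {W | ∃ A ∈ f a, ∃ B ∈ SubstSet f w, W = A ++ B}

/-- The word `P = abacbcabcbacabacbcabcbabcacbcabcbacabacbcabcbacbc` (a=0, b=1, c=2). -/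
def Pw : List (Fin 3) :=
  [0,1,0,2,1,2,0,1,2,1,0,2,0,1,0,2,1,2,0,1,2,1,0,1,2,0,2,1,2,0,1,2,1,0,2,0,1,0,2,1,2,0,1,2,1,0,2,1,2]

/-- The word `Q = abacbabcacbacabacbcacbacabcbabcabacbcabcb`. -/
def Qw : List (Fin 3) :=
  [0,1,0,2,1,0,1,2,0,2,1,0,2,0,1,0,2,1,2,0,2,1,0,2,0,1,2,1,0,1,2,0,1,0,2,1,2,0,1,2,1]

/-- The word `R = abacabcacbacabcbabcacbacabacbcacbacabcbabcabacbcabcb`. -/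
def Rw : List (Fin 3) :=
  [0,1,0,2,0,1,2,0,2,1,0,2,0,1,2,1,0,1,2,0,2,1,0,2,0,1,0,2,1,2,0,2,1,0,2,0,1,2,1,0,1,2,0,1,0,2,1,2,0,1,2,1]

/-- The word `S = acabacbabcacbacabcbacbcabacbabcacbacabcbabcacbaca`. -/
def Sw : List (Fin 3) :=
  [0,2,0,1,0,2,1,0,1,2,0,2,1,0,2,0,1,2,1,0,2,1,2,0,1,0,2,1,0,1,2,0,2,1,0,2,0,1,2,1,0,1,2,0,2,1,0,2,0]

/-- The identity permutation `()` of `Γ = {a,b,c}` (with `a = 0`, `b = 1`, `c = 2`). -/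
def pid : Equiv.Perm (Fin 3) := 1
/-- The permutation `(ab)`. -/
def pab : Equiv.Perm (Fin 3) := Equiv.swap 0 1
/-- The permutation `(ac)`. -/
def pac : Equiv.Perm (Fin 3) := Equiv.swap 0 2
/-- The permutation `(bc)`. -/
def pbc : Equiv.Perm (Fin 3) := Equiv.swap 1 2
/-- The permutation `(abc)`, i.e. `a ↦ b ↦ c ↦ a`. -/
def pabc : Equiv.Perm (Fin 3) := (Equiv.swap 0 1).trans (Equiv.swap 0 2)
/-- The permutation `(acb)`, i.e. `a ↦ c ↦ b ↦ a`. -/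
def pacb : Equiv.Perm (Fin 3) := (Equiv.swap 0 2).trans (Equiv.swap 0 1)

/-- The vertex set `V(D) = S_Γ ∪ S̃_Γ`: a permutation `π` together with a Boolean
which is `false` for the plain letter `π` and `true` for its mirror image `π̃`. -/
abbrev V : Type := Equiv.Perm (Fin 3) × Bool

/-- The 24 arcs of the digraph `D`. -/
def arcs : List (V × V) :=
  [((pid,false),(pab,true)), ((pac,true),(pid,false)), ((pab,false),(pid,true)),
   ((pacb,true),(pab,false)), ((pid,true),(pac,false)), ((pac,false),(pabc,true)),
   ((pabc,true),(pbc,false)), ((pbc,false),(pacb,true)), ((pabc,false),(pac,true)),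
   ((pbc,true),(pabc,false)), ((pab,true),(pacb,false)), ((pacb,false),(pbc,true)),
   ((pid,false),(pbc,false)), ((pbc,false),(pid,false)), ((pab,false),(pabc,false)),
   ((pabc,false),(pab,false)), ((pac,false),(pacb,false)), ((pacb,false),(pac,false)),
   ((pbc,true),(pid,true)), ((pid,true),(pbc,true)), ((pabc,true),(pab,true)),
   ((pab,true),(pabc,true)), ((pacb,true),(pac,true)), ((pac,true),(pacb,true))]

/-- The arc relation of the digraph `D`. -/
def Arc (x y : V) : Prop := (x, y) ∈ arcs

/-- For `x = (π, false)` this is `W_π` (permute letters by `π`);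
for `x = (π, true)` this is `W_π̃` (the reversal of `W_π`). -/
def applyV (x : V) (w : List (Fin 3)) : List (Fin 3) :=
  if x.2 then (w.map x.1).reverse else w.map x.1

/-- The vertex set of `D̂`: original vertices `Sum.inl x`, plus the new letters
`p_x = Sum.inr (x, false)` and `s_x = Sum.inr (x, true)`. -/
abbrev Vhat : Type := V ⊕ (V × Bool)

/-- The arc relation of the digraph `D̂`: the arcs of `D`, together with an arc
from `p_x` to `x` and an arc from `x` to `s_x`, for each vertex `x` of `D`. -/
def ArcHat : Vhat → Vhat → Prop
  | Sum.inl x, Sum.inl y => Arc x y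
  | Sum.inr (x, false), Sum.inl y => x = y
  | Sum.inl x, Sum.inr (y, true) => x = y
  | _, _ => False

/-- The unique word in `δ(p_x)`: `P_x` if `x ∈ S_Γ`, and `S_x` if `x ∈ S̃_Γ`. -/
def pword (x : V) : List (Fin 3) := applyV x (if x.2 then Sw else Pw)

/-- The unique word in `δ(s_x)`: `S_x` if `x ∈ S_Γ`, and `P_x` if `x ∈ S̃_Γ`. -/
def sword (x : V) : List (Fin 3) := applyV x (if x.2 then Pw else Sw)

/-- The substitution `δ` on the letters of `V(D̂)`. -/
def delta : Vhat → Set (List (Fin 3))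
  | Sum.inl x => {applyV x Qw, applyV x Rw}
  | Sum.inr (x, false) => {pword x}
  | Sum.inr (x, true) => {sword x}

/-! ### Finite data -/

/-- All vertices of `D`. -/
def vertices : List V :=
  [pid, pab, pac, pbc, pabc, pacb].flatMap fun π => [(π, false), (π, true)]

/-- The words of `delta a`, as a list. -/
def blocks : Vhat → List (List (Fin 3))
  | Sum.inl x => [applyV x Qw, applyV x Rw]
  | Sum.inr (x, false) => [pword x]
  | Sum.inr (x, true) => [sword x]

/-- The vertex of `D` carried by a letter, if any. -/
def label : Vhat → List V
  | Sum.inl x => [x]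
  | Sum.inr _ => []

/-- The arcs of `D`, as arcs of `D̂`. -/
def arcsD : List (Vhat × Vhat) := arcs.map fun e => (Sum.inl e.1, Sum.inl e.2)

/-- The arcs of `D̂`. -/
def arcsHat : List (Vhat × Vhat) :=
  arcsD ++ vertices.flatMap fun x =>
    [(Sum.inr (x, false), Sum.inl x), (Sum.inl x, Sum.inr (x, true))]

theorem mem_vertices (x : V) : x ∈ vertices := by
  revert x; decide +kernel

theorem delta_eq_blocks (a : Vhat) (A : List (Fin 3)) : A ∈ delta a ↔ A ∈ blocks a := by
  rcases a with x | ⟨x, _ | _⟩ <;> simp [delta, blocks]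

theorem mem_arcsHat {a b : Vhat} (h : ArcHat a b) : (a, b) ∈ arcsHat := by
  rcases a with x | ⟨x, _ | _⟩ <;> rcases b with y | ⟨y, _ | _⟩ <;>
    simp_all [ArcHat, arcsHat, arcsD, Arc, mem_vertices]

theorem arcHat_of_mem_arcsD {a b : Vhat} (h : (a, b) ∈ arcsD) : ArcHat a b := by
  simp only [arcsD, List.mem_map, Prod.mk.injEq] at h
  obtain ⟨⟨x, y⟩, he, rfl, rfl⟩ := h
  exact he

theorem exists_inl_of_arcHat_of_arcHat {a b c : Vhat} (h : ArcHat a b) (h' : ArcHat b c) :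
    ∃ x, b = Sum.inl x := by
  rcases a with x | ⟨x, _ | _⟩ <;> rcases b with y | ⟨y, _ | _⟩ <;>
    rcases c with z | ⟨z, _ | _⟩ <;> simp_all [ArcHat]

theorem length_le_of_mem_blocks {a : Vhat} {A : List (Fin 3)} (h : A ∈ blocks a) :
    41 ≤ A.length := by
  have key : ∀ (x : V) (U : List (Fin 3)), (applyV x U).length = U.length := by
    intro x U
    unfold applyV
    split <;> simp
  rcases a with x | ⟨x, _ | _⟩
  · simp only [blocks, List.mem_cons, List.not_mem_nil, or_false] at h
    rcases h with rfl | rfl <;> rw [key] <;> decide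
  · simp only [blocks, List.mem_cons, List.not_mem_nil, or_false] at h
    subst h
    rw [pword, key]
    split <;> decide
  · simp only [blocks, List.mem_cons, List.not_mem_nil, or_false] at h
    subst h
    rw [sword, key]
    split <;> decide

/-! ### Substitution and factors -/

section Substitution

theorem mem_substSet_cons {a : Vhat} {w : List Vhat} {W : List (Fin 3)} :
    W ∈ SubstSet delta (a :: w) ↔
      ∃ A ∈ blocks a, ∃ B ∈ SubstSet delta w, W = A ++ B := by
  simp [SubstSet, delta_eq_blocks]

theorem mem_substSet_append {w w' : List Vhat} {W : List (Fin 3)} :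
    W ∈ SubstSet delta (w ++ w') ↔
      ∃ A ∈ SubstSet delta w, ∃ B ∈ SubstSet delta w', W = A ++ B := by
  induction w generalizing W with
  | nil => simp [SubstSet]
  | cons a w ih =>
    simp only [List.cons_append, mem_substSet_cons, ih]
    constructor
    · rintro ⟨A, hA, _, ⟨B, hB, C, hC, rfl⟩, rfl⟩
      exact ⟨A ++ B, ⟨A, hA, B, hB, rfl⟩, C, hC, by simp⟩
    · rintro ⟨_, ⟨A, hA, B, hB, rfl⟩, C, hC, rfl⟩
      exact ⟨A, hA, B ++ C, ⟨B, hB, C, hC, rfl⟩, by simp⟩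

theorem mem_substSet_singleton {a : Vhat} {W : List (Fin 3)} :
    W ∈ SubstSet delta [a] ↔ W ∈ blocks a := by
  simp [SubstSet, delta_eq_blocks]

theorem SquareFree.of_infix {α : Type*} {u w : List α} (hw : SquareFree w) (h : u <:+: w) :
    SquareFree u :=
  fun x hx hxx => hw x hx (hxx.trans h)

/-- `U` is a factor of the image of some arc. -/
def PairFactor (E : Vhat → Vhat → Prop) (U : List (Fin 3)) : Prop :=
  ∃ a b, E a b ∧ ∃ A ∈ blocks a, ∃ B ∈ blocks b, U <:+: A ++ B

variable {E : Vhat → Vhat → Prop}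

theorem pairFactor_of_infix_block {a : Vhat} {A U : List (Fin 3)} (hA : A ∈ blocks a)
    (ha : ∃ b, E a b ∨ E b a) (hU : U <:+: A) : PairFactor E U := by
  have hne : ∀ b, ∃ B, B ∈ blocks b := by
    rintro (x | ⟨x, _ | _⟩) <;> exact ⟨_, List.mem_cons_self⟩
  obtain ⟨b, hb | hb⟩ := ha <;> obtain ⟨B, hB⟩ := hne b
  · exact ⟨a, b, hb, A, hA, B, hB, hU.trans (List.prefix_append A B).isInfix⟩
  · exact ⟨b, a, hb, B, hB, A, hA, hU.trans (List.suffix_append B A).isInfix⟩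

theorem pairFactor_or_block_infix (hE : ∀ a b, E a b → ArcHat a b) {w : List Vhat}
    (hext : ∀ a ∈ w, ∃ b, E a b ∨ E b a) (hw : w.IsChain E) {W U : List (Fin 3)}
    (hW : W ∈ SubstSet delta w) (hU : U <:+: W) (hne : U ≠ []) :
    PairFactor E U ∨ ∃ x, Sum.inl x ∈ w ∧ ∃ B ∈ blocks (Sum.inl x), B <:+: U := by
  induction w generalizing W with
  | nil =>
    obtain rfl : W = [] := hW
    exact absurd (List.infix_nil.1 hU) hne
  | cons a w ih =>
    obtain ⟨A, hA, W', hW', rfl⟩ := mem_substSet_cons.1 hW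
    obtain ⟨s, t, hst⟩ := hU
    rw [List.append_assoc, List.append_eq_append_iff] at hst
    rcases hst with ⟨A', rfl, h⟩ | ⟨s', rfl, h⟩
    · rcases w with _ | ⟨b, w⟩
      · obtain rfl : W' = [] := hW'
        refine Or.inl (pairFactor_of_infix_block hA (hext a (by simp)) ?_)
        exact ⟨s, t, by simp [h]⟩
      · obtain ⟨B, hB, W'', hW'', rfl⟩ := mem_substSet_cons.1 hW'
        rw [List.isChain_cons_cons] at hw
        have hpair : ∀ r, A' ++ B = U ++ r → PairFactor E U := fun r hr =>
          ⟨a, b, hw.1, _, hA, B, hB, s, r, by simp [hr]⟩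
        rw [← List.append_assoc, List.append_eq_append_iff] at h
        rcases h with ⟨r, hr, -⟩ | ⟨r, hr, hr'⟩
        · exact Or.inl (hpair r hr)
        · rcases w with _ | ⟨c, w⟩
          · obtain rfl : W'' = [] := hW''
            obtain ⟨rfl, rfl⟩ : r = [] ∧ t = [] := by simpa using hr'.symm
            exact Or.inl (hpair [] (by simp [hr]))
          · obtain ⟨x, rfl⟩ := exists_inl_of_arcHat_of_arcHat (hE _ _ hw.1)
              (hE _ _ (List.isChain_cons_cons.1 hw.2).1)
            exact Or.inr ⟨x, by simp, B, hB, A', r, by simp [hr]⟩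
    · rcases ih (fun b hb => hext b (by simp [hb])) hw.tail hW' ⟨s', t, by simp [h]⟩ with
        h | ⟨x, hx, h⟩
      · exact Or.inl h
      · exact Or.inr ⟨x, by simp [hx], h⟩

end Substitution

/-- The vertices of `D` on a walk in `D̂` form a contiguous part of it. -/
theorem map_inl_label_infix {w : List Vhat} (hw : w.IsChain ArcHat) :
    (w.flatMap label).map Sum.inl <:+: w := by
  have key : ∀ (w : List Vhat) (a : Vhat), (a :: w).IsChain ArcHat →
      (w.flatMap label).map Sum.inl <+: w := by
    intro w
    induction w with
    | nil => simp
    | cons b w ih =>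
      intro a h
      have hb := ih b h.tail
      rw [List.isChain_cons_cons] at h
      rcases b with y | ⟨y, i⟩
      · simpa [label] using hb
      · rcases w with _ | ⟨c, w⟩
        · simp [label]
        · obtain ⟨x, hx⟩ :=
            exists_inl_of_arcHat_of_arcHat h.1 (List.isChain_cons_cons.1 h.2).1
          cases hx
  rcases w with _ | ⟨a, w⟩
  · simp
  · have h := key w a hw
    rcases a with x | x
    · exact List.IsPrefix.isInfix (by simpa [label] using h)
    · exact List.IsInfix.trans (by simpa [label] using h.isInfix) (List.suffix_cons _ w).isInfix

/-! ### Tokens -/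

section Tokens

/-- `tok` looks only at a window of length `L`, and rejects shorter words. -/
structure IsWindow (L : ℕ) (tok : List (Fin 3) → Option V) : Prop where
  eq_none_of_lt : ∀ U, U.length < L → tok U = none
  append : ∀ U Z, L ≤ U.length → tok (U ++ Z) = tok U

/-- The tokens of `A ++ Z` that start in `A`. -/
def scan (tok : List (Fin 3) → Option V) : List (Fin 3) → List (Fin 3) → List V
  | [], _ => []
  | a :: A, Z => (tok (a :: (A ++ Z))).toList ++ scan tok A Z

/-- The positions, counted from `i`, at which `tok` accepts. -/
def occ (tok : List (Fin 3) → Option V) : ℕ → List (Fin 3) → List ℕ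
  | _, [] => []
  | i, a :: U => if (tok (a :: U)).isSome then i :: occ tok (i + 1) U else occ tok (i + 1) U

variable {tok : List (Fin 3) → Option V} {L : ℕ}

theorem scan_append_left (A B Z : List (Fin 3)) :
    scan tok (A ++ B) Z = scan tok A (B ++ Z) ++ scan tok B Z := by
  induction A with
  | nil => rfl
  | cons a A ih => simp [scan, ih]

theorem scan_append_right (ht : IsWindow L tok) (A B Z : List (Fin 3)) (hB : L ≤ B.length) :
    scan tok A (B ++ Z) = scan tok A B := by
  induction A with
  | nil => rfl
  | cons a A ih =>
    have := ht.append (a :: (A ++ B)) Z (by simp; omega)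
    simp only [List.cons_append, List.append_assoc] at this
    simp [scan, ih, this]

theorem scan_nil_prefix (ht : IsWindow L tok) (U Z : List (Fin 3)) :
    scan tok U [] <+: scan tok U Z := by
  induction U with
  | nil => simp [scan]
  | cons a U ih =>
    have hshort : ∀ U' : List (Fin 3), U'.length < L → scan tok U' [] = [] := by
      intro U'
      induction U' with
      | nil => simp [scan]
      | cons b U' ih' =>
        intro h
        simp only [List.length_cons] at h
        simp [scan, ih' (by omega), ht.eq_none_of_lt (b :: U') (by simpa using h)]
    by_cases h : (a :: U).length < L
    · simp [hshort _ h]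
    · have := ht.append (a :: U) Z (by omega)
      simp only [List.cons_append] at this
      simpa [scan, this] using ih

theorem scan_nil_infix (ht : IsWindow L tok) {U W : List (Fin 3)} (h : U <:+: W) :
    scan tok U [] <:+: scan tok W [] := by
  obtain ⟨s, t, rfl⟩ := h
  rw [List.append_assoc, scan_append_left, scan_append_left U]
  simp only [List.append_nil]
  exact ((scan_nil_prefix ht U t).trans (List.prefix_append _ _)).isInfix.trans
    (List.suffix_append _ _).isInfix

/-- Some accepted window straddles the middle of `X ++ X`; it is split there as `u ++ v`. -/
def Straddle (tok : List (Fin 3) → Option V) (L : ℕ) (X u v : List (Fin 3)) : Prop :=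
  u ≠ [] ∧ v ≠ [] ∧ u.length + v.length = L ∧ (tok (u ++ v)).isSome ∧ u <:+ X ∧ v <+: X

theorem exists_straddle_of_scan_ne (ht : IsWindow L tok) (X : List (Fin 3))
    (h : scan tok (X ++ X) [] ≠ scan tok X [] ++ scan tok X []) :
    ∃ u v, Straddle tok L X u v := by
  by_contra! hcon
  apply h
  rw [scan_append_left]
  congr 1
  have key : ∀ Y, Y <:+ X → scan tok Y (X ++ []) = scan tok Y [] := by
    intro Y
    induction Y with
    | nil => simp [scan]
    | cons a Y ih =>
      intro hY
      rw [scan, scan, ih ((List.suffix_cons a Y).trans hY)]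
      congr 2
      simp only [List.append_nil]
      by_cases hL : L ≤ (a :: Y).length
      · exact ht.append (a :: Y) X hL
      · rw [ht.eq_none_of_lt (a :: Y) (by omega)]
        by_contra hne
        have hlen : L ≤ (a :: (Y ++ X)).length := by
          by_contra hlt
          exact hne (ht.eq_none_of_lt _ (by omega))
        simp only [List.length_cons, List.length_append] at hL hlen
        refine hcon (a :: Y) (X.take (L - (Y.length + 1))) ⟨by simp, ?_, ?_, ?_, hY, ?_⟩
        · rw [← List.length_pos_iff]
          simp; omega
        · simp; omega
        · have := ht.append (a :: Y ++ X.take (L - (Y.length + 1)))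
            (X.drop (L - (Y.length + 1))) (by simp; omega)
          rw [List.append_assoc, List.take_append_drop] at this
          rw [← this]
          exact Option.isSome_iff_ne_none.2 hne
        · exact List.take_prefix _ _
  exact key X List.suffix_rfl

theorem mem_occ (i p : ℕ) (U : List (Fin 3)) (hp : p < U.length)
    (h : (tok (U.drop p)).isSome) : i + p ∈ occ tok i U := by
  induction U generalizing i p with
  | nil => simp at hp
  | cons a U ih =>
    rcases p with _ | p
    · rw [List.drop_zero] at h
      simp [occ, h]
    · have := ih (i + 1) p (by simpa using hp) (by simpa using h)
      rw [show i + (p + 1) = i + 1 + p by omega]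
      rw [occ]
      split
      · exact List.mem_cons_of_mem _ this
      · exact this

variable {E : Vhat → Vhat → Prop}

theorem scan_eq_flatMap_label (ht : IsWindow L tok) (hL : L ≤ 41)
    (hpair : ∀ a b, E a b → ∀ A ∈ blocks a, ∀ B ∈ blocks b, scan tok A B = label a)
    {w : List Vhat} (hone : ∀ a ∈ w, ∀ A ∈ blocks a, scan tok A [] = label a)
    (hw : w.IsChain E) {W : List (Fin 3)} (hW : W ∈ SubstSet delta w) :
    scan tok W [] = w.flatMap label := by
  induction w generalizing W with
  | nil =>
    obtain rfl : W = [] := hW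
    rfl
  | cons a w ih =>
    obtain ⟨A, hA, W', hW', rfl⟩ := mem_substSet_cons.1 hW
    rw [scan_append_left, ih (fun b hb => hone b (by simp [hb])) hw.tail hW', List.flatMap_cons]
    congr 1
    rcases w with _ | ⟨b, w⟩
    · obtain rfl : W' = [] := hW'
      exact hone a (by simp) A hA
    · obtain ⟨B, hB, W'', -, rfl⟩ := mem_substSet_cons.1 hW'
      rw [List.append_nil, scan_append_right ht _ _ _ (hL.trans (length_le_of_mem_blocks hB))]
      exact hpair a b (List.isChain_cons_cons.1 hw).1 A hA B hB

/-- If the tokens read off the vertices of walks, every square in the image of a square-free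
walk has a token straddling its middle. -/
theorem exists_straddle (ht : IsWindow L tok) (hL : L ≤ 41) (hE : ∀ a b, E a b → ArcHat a b)
    (hsq : ∀ U, PairFactor E U → SquareFree U)
    (hpair : ∀ a b, E a b → ∀ A ∈ blocks a, ∀ B ∈ blocks b, scan tok A B = label a)
    {w : List Vhat} (hone : ∀ a ∈ w, ∀ A ∈ blocks a, scan tok A [] = label a)
    (hext : ∀ a ∈ w, ∃ b, E a b ∨ E b a)
    (hw : w.IsChain E) (hsf : SquareFree w) {W X : List (Fin 3)} (hW : W ∈ SubstSet delta w)
    (hX : X ≠ []) (hXX : X ++ X <:+: W) : ∃ u v, Straddle tok L X u v := by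
  by_contra hcon
  have hscan : scan tok (X ++ X) [] = scan tok X [] ++ scan tok X [] := by
    by_contra h
    exact hcon (exists_straddle_of_scan_ne ht X h)
  have hinf := scan_nil_infix ht hXX
  rw [scan_eq_flatMap_label ht hL hpair hone hw hW, hscan] at hinf
  by_cases hnil : scan tok X [] = []
  · rcases pairFactor_or_block_infix hE hext hw hW hXX (by simp [hX]) with h | ⟨x, hx, B, hB, h⟩
    · exact hsq _ h X hX List.infix_rfl
    · have := scan_nil_infix ht h
      rw [hscan, hnil, hone _ hx B hB] at this
      simp [label] at this
  · refine hsf ((scan tok X []).map Sum.inl) (by simpa using hnil) ?_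
    rw [← List.map_append]
    exact (hinf.map _).trans (map_inl_label_infix (hw.imp hE))

/-- Two tokens straddling the middle of the same square occur together in the image of an arc. -/
theorem Straddle.exists_common_pair {tok' : List (Fin 3) → Option V} (ht : IsWindow L tok)
    (ht' : IsWindow L tok') (hL : 2 * L ≤ 42) (hE : ∀ a b, E a b → ArcHat a b) {w : List Vhat}
    (hext : ∀ a ∈ w, ∃ b, E a b ∨ E b a) (hw : w.IsChain E)
    {W X u v u' v' : List (Fin 3)} (hW : W ∈ SubstSet delta w) (hXX : X ++ X <:+: W)
    (h : Straddle tok L X u v) (h' : Straddle tok' L X u' v') :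
    ∃ a b, E a b ∧ ∃ A ∈ blocks a, ∃ B ∈ blocks b, ∃ p q,
      p ∈ occ tok 0 (A ++ B) ∧ q ∈ occ tok' 0 (A ++ B) ∧ p + u.length = q + u'.length ∧
      (∃ r, (A ++ B).drop p = u ++ v ++ r) ∧ ∃ r, (A ++ B).drop q = u' ++ v' ++ r := by
  obtain ⟨hu, hv, huv, hm, huX, hvX⟩ := h
  obtain ⟨hu', hv', huv', hm', huX', hvX'⟩ := h'
  have hu0 := List.length_pos_iff.2 hu
  have hv0 := List.length_pos_iff.2 hv
  have hu0' := List.length_pos_iff.2 hu'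
  have hv0' := List.length_pos_iff.2 hv'
  obtain ⟨e, heX, he, ⟨e₁, rfl⟩, ⟨e₂, he₂⟩⟩ :
      ∃ e, e <:+ X ∧ e.length < L ∧ u <:+ e ∧ u' <:+ e := by
    rcases le_total u.length u'.length with hle | hle
    · exact ⟨u', huX', by omega, List.suffix_of_suffix_length_le huX huX' hle, List.suffix_rfl⟩
    · exact ⟨u, huX, by omega, List.suffix_rfl, List.suffix_of_suffix_length_le huX' huX hle⟩
  obtain ⟨f, hfX, hf, ⟨f₁, rfl⟩, ⟨f₂, hf₂⟩⟩ :
      ∃ f, f <+: X ∧ f.length < L ∧ v <+: f ∧ v' <+: f := by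
    rcases le_total v.length v'.length with hle | hle
    · exact ⟨v', hvX', by omega, List.prefix_of_prefix_length_le hvX hvX' hle, List.prefix_rfl⟩
    · exact ⟨v, hvX, by omega, List.prefix_rfl, List.prefix_of_prefix_length_le hvX' hvX hle⟩
  have hwin : e₁ ++ u ++ (v ++ f₁) <:+: W := by
    refine List.IsInfix.trans ?_ hXX
    obtain ⟨s, hs⟩ := heX
    obtain ⟨t, ht⟩ := hfX
    exact ⟨s, t, by rw [← List.append_assoc, hs, List.append_assoc, ht]⟩
  rcases pairFactor_or_block_infix hE hext hw hW hwin (by simp [hu]) with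
    ⟨a, b, hab, A, hA, B, hB, s, t, hst⟩ | ⟨x, -, B, hB, hBU⟩
  · have hp : (A ++ B).drop (s ++ e₁).length = u ++ v ++ (f₁ ++ t) := by
      rw [← hst, show s ++ (e₁ ++ u ++ (v ++ f₁)) ++ t = (s ++ e₁) ++ (u ++ v ++ (f₁ ++ t)) by
        simp, List.drop_left]
    have hq : (A ++ B).drop (s ++ e₂).length = u' ++ v' ++ (f₂ ++ t) := by
      rw [← hst, ← he₂, ← hf₂,
        show s ++ (e₂ ++ u' ++ (v' ++ f₂)) ++ t = (s ++ e₂) ++ (u' ++ v' ++ (f₂ ++ t)) by simp,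
        List.drop_left]
    have hlen := congrArg List.length hp
    have hlen' := congrArg List.length hq
    have hcut := congrArg List.length he₂
    simp only [List.length_drop, List.length_append] at hlen hlen' hcut
    refine ⟨a, b, hab, A, hA, B, hB, (s ++ e₁).length, (s ++ e₂).length, ?_, ?_, ?_,
      ⟨_, hp⟩, ⟨_, hq⟩⟩
    · rw [← Nat.zero_add (s ++ e₁).length]
      refine mem_occ _ _ _ (by simp only [List.length_append]; omega) ?_
      rw [hp, ht.append _ _ (by simp [huv])]
      exact hm
    · rw [← Nat.zero_add (s ++ e₂).length]
      refine mem_occ _ _ _ (by simp only [List.length_append]; omega) ?_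
      rw [hq, ht'.append _ _ (by simp [huv'])]
      exact hm'
    · simp only [List.length_append]
      omega
  · have h₁ := hBU.length_le
    have h₂ := length_le_of_mem_blocks hB
    simp only [List.length_append] at h₁ he hf
    omega

end Tokens

/-! ### Tries -/

/-- A ternary trie whose leaves carry vertices of `D`. -/
inductive Trie : Type
  | empty : Trie
  | leaf (x : V) : Trie
  | node (a b c : Trie) : Trie

namespace Trie

def singleton (x : V) : List (Fin 3) → Trie
  | [] => leaf x
  | 0 :: m => node (singleton x m) empty empty
  | 1 :: m => node empty (singleton x m) empty
  | 2 :: m => node empty empty (singleton x m)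

def union : Trie → Trie → Trie
  | empty, t => t
  | t, empty => t
  | node a b c, node a' b' c' => node (union a a') (union b b') (union c c')
  | t, _ => t

/-- The trie of the words `applyV x m` with `m ∈ f x`, each labelled by `x`. -/
def ofWords (f : V → List (List (Fin 3))) : Trie :=
  vertices.foldr (fun x t => (f x).foldr (fun m t => (singleton x (applyV x m)).union t) t) empty

/-- The label of the prefix of the given word that belongs to the trie. -/
def find : Trie → List (Fin 3) → Option V
  | empty, _ => none
  | leaf x, _ => some x
  | node _ _ _, [] => none
  | node a b c, d :: U =>
    match d.val with
    | 0 => find a U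
    | 1 => find b U
    | _ => find c U

/-- All leaves have the given depth. -/
def uniform : ℕ → Trie → Bool
  | _, empty => true
  | 0, leaf _ => true
  | n + 1, node a b c => uniform n a && uniform n b && uniform n c
  | _, _ => false

theorem isWindow_find {n : ℕ} {t : Trie} (h : uniform n t = true) : IsWindow n t.find := by
  constructor
  · induction t generalizing n with
    | empty => simp [find]
    | leaf x => cases n <;> simp_all [uniform]
    | node a b c iha ihb ihc =>
      rcases n with _ | n
      · simp [uniform] at h
      · simp only [uniform, Bool.and_eq_true] at h
        rintro (_ | ⟨d, U⟩) hU
        · rfl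
        · simp only [List.length_cons, add_lt_add_iff_right] at hU
          rw [find]
          split
          exacts [iha h.1.1 U hU, ihb h.1.2 U hU, ihc h.2 U hU]
  · induction t generalizing n with
    | empty => simp [find]
    | leaf x => simp [find]
    | node a b c iha ihb ihc =>
      rcases n with _ | n
      · simp [uniform] at h
      · simp only [uniform, Bool.and_eq_true] at h
        rintro (_ | ⟨d, U⟩) Z hU
        · simp at hU
        · simp only [List.length_cons, add_le_add_iff_right] at hU
          rw [List.cons_append, find, find]
          split
          exacts [iha h.1.1 U Z hU, ihb h.1.2 U Z hU, ihc h.2 U Z hU]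

end Trie

/-! ### Squares by bit masks -/

/-- The set of positions of the letter `c`, as a bit mask. -/
def mask (c : Fin 3) : List (Fin 3) → ℕ
  | [] => 0
  | a :: l => Nat.bit (a == c) (mask c l)

/-- The bits of `r` that are followed by `k` ones in `z` are all absent. -/
def noRun (z : ℕ) : ℕ → ℕ → Bool
  | 0, r => r.beq 0
  | k + 1, r => bif r.beq 0 then true else noRun (z / 2) k (r &&& (z / 2))

/-- No square of period at most `n`, in terms of the masks of the three letters. -/
def noSquareMask (a b c : ℕ) : ℕ → Bool
  | 0 => true
  | p + 1 =>
    (fun z => noRun z p z)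
      ((a &&& (a >>> (p + 1))) ||| (b &&& (b >>> (p + 1))) ||| (c &&& (c >>> (p + 1)))) &&
    noSquareMask a b c p

def noSquare (U : List (Fin 3)) : Bool :=
  noSquareMask (mask 0 U) (mask 1 U) (mask 2 U) (U.length / 2)

theorem testBit_mask {c : Fin 3} {l : List (Fin 3)} {i : ℕ} (h : l[i]? = some c) :
    (mask c l).testBit i = true := by
  induction l generalizing i with
  | nil => simp at h
  | cons a l ih =>
    rcases i with _ | i
    · simp only [List.getElem?_cons_zero, Option.some.injEq] at h
      simp [mask, h]
    · simp only [List.getElem?_cons_succ] at h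
      simp [mask, Nat.testBit_bit_succ, ih h]

theorem noRun_spec {z k r i : ℕ} (h : noRun z k r = true) (hr : r.testBit i = true)
    (hz : ∀ j, j < k → z.testBit (i + (j + 1)) = true) : False := by
  induction k generalizing z r with
  | zero =>
    obtain rfl : r = 0 := Nat.eq_of_beq_eq_true h
    simp at hr
  | succ k ih =>
    rw [noRun] at h
    rcases hb : r.beq 0 with _ | _
    · rw [hb] at h
      refine ih h ?_ fun j hj => ?_
      · simpa [hr, Nat.testBit_div_two] using hz 0 (by omega)
      · rw [Nat.testBit_div_two]
        exact hz (j + 1) (by omega)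
    · obtain rfl : r = 0 := Nat.eq_of_beq_eq_true hb
      simp at hr

theorem squareFree_of_noSquare {U : List (Fin 3)} (h : noSquare U = true) : SquareFree U := by
  rintro X hX ⟨s, t, hst⟩
  have hpos := List.length_pos_iff.2 hX
  have key : ∀ n, X.length ≤ n → noSquareMask (mask 0 U) (mask 1 U) (mask 2 U) n = true → False := by
    intro n hn hsq
    induction n with
    | zero => omega
    | succ p ih =>
      rw [noSquareMask, Bool.and_eq_true] at hsq
      rcases Nat.lt_or_ge p X.length with hp | hp
      · have hpX : X.length = p + 1 := by omega
        have hmatch : ∀ j, j < p + 1 →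
            ((mask 0 U &&& (mask 0 U >>> (p + 1))) ||| (mask 1 U &&& (mask 1 U >>> (p + 1))) |||
              (mask 2 U &&& (mask 2 U >>> (p + 1)))).testBit (s.length + j) = true := by
          intro j hj
          obtain ⟨c, hc⟩ : ∃ c, X[j]? = some c := ⟨_, List.getElem?_eq_getElem (by omega)⟩
          have h₁ : U[s.length + j]? = some c := by
            rw [← hst, List.append_assoc, List.getElem?_append_right (by omega),
              List.append_assoc, List.getElem?_append_left (by omega)]
            simpa using hc
          have h₂ : U[p + 1 + (s.length + j)]? = some c := by
            rw [← hst, List.append_assoc, List.getElem?_append_right (by omega),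
              List.append_assoc, List.getElem?_append_right (by omega),
              List.getElem?_append_left (by omega), ← hc]
            congr 1
            omega
          have t₁ := testBit_mask h₁
          have t₂ := testBit_mask h₂
          simp only [Nat.testBit_lor, Nat.testBit_land, Nat.testBit_shiftRight, Bool.or_eq_true,
            Bool.and_eq_true]
          fin_cases c
          exacts [Or.inl (Or.inl ⟨t₁, t₂⟩), Or.inl (Or.inr ⟨t₁, t₂⟩), Or.inr ⟨t₁, t₂⟩]
        exact noRun_spec hsq.1 (hmatch 0 (by omega)) fun j hj => hmatch (j + 1) (by omega)
      · exact ih hp hsq.2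
  refine key _ ?_ h
  rw [← hst]
  simp only [List.length_append]
  omega

/-! ### Checks on pairs of blocks -/

/-- Prefixes of `Q` and `R`. -/
def prefixTrie : Trie := Trie.ofWords fun _ => [Qw.take 21, Rw.take 21]

/-- The common central part of `Q` and `R`. -/
def coreTrie : Trie := Trie.ofWords fun _ => [(Qw.drop 16).take 21]

/-- The common suffix of `Q` and `R`. -/
def suffixTrie : Trie := Trie.ofWords fun _ => [Qw.drop 20]

/-- What precedes the end of a short overlap of a prefix and a central part. -/
def leftTrie : Trie :=
  Trie.ofWords fun x => [if x.2 then (Qw.drop 20).take 17 else Qw.take 17]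

/-- What follows the beginning of a short overlap of a prefix and a central part. -/
def rightTrie : Trie :=
  Trie.ofWords fun x => [if x.2 then Qw.take 17 else (Qw.drop 20).take 17]

theorem isWindow_prefixTrie : IsWindow 21 prefixTrie.find :=
  Trie.isWindow_find (by decide +kernel)

theorem isWindow_coreTrie : IsWindow 21 coreTrie.find :=
  Trie.isWindow_find (by decide +kernel)

theorem isWindow_suffixTrie : IsWindow 21 suffixTrie.find :=
  Trie.isWindow_find (by decide +kernel)

theorem isWindow_leftTrie : IsWindow 17 leftTrie.find :=
  Trie.isWindow_find (by decide +kernel)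

theorem isWindow_rightTrie : IsWindow 17 rightTrie.find :=
  Trie.isWindow_find (by decide +kernel)

section Checks

set_option maxRecDepth 100000

theorem noSquare_of_mem_arcsHat :
    ∀ e ∈ arcsHat, ∀ A ∈ blocks e.1, ∀ B ∈ blocks e.2, noSquare (A ++ B) = true := by
  decide +kernel

theorem scan_prefixTrie_of_mem_arcsHat :
    ∀ e ∈ arcsHat, ∀ A ∈ blocks e.1, ∀ B ∈ blocks e.2,
      scan prefixTrie.find A B = label e.1 := by
  decide +kernel

theorem scan_coreTrie_of_mem_arcsHat :
    ∀ e ∈ arcsHat, ∀ A ∈ blocks e.1, ∀ B ∈ blocks e.2,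
      scan coreTrie.find A B = label e.1 := by
  decide +kernel

theorem scan_suffixTrie_of_mem_arcsD :
    ∀ e ∈ arcsD, ∀ A ∈ blocks e.1, ∀ B ∈ blocks e.2,
      scan suffixTrie.find A B = label e.1 := by
  decide +kernel

theorem scan_prefixTrie_block (a : Vhat) : ∀ A ∈ blocks a, scan prefixTrie.find A [] = label a := by
  have key : ∀ x ∈ vertices, ∀ a ∈ [Sum.inl x, Sum.inr (x, false), Sum.inr (x, true)],
      ∀ A ∈ blocks a, scan prefixTrie.find A [] = label a := by decide +kernel
  rcases a with x | ⟨x, _ | _⟩ <;> exact key x (mem_vertices x) _ (by simp)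

theorem scan_coreTrie_block (a : Vhat) : ∀ A ∈ blocks a, scan coreTrie.find A [] = label a := by
  have key : ∀ x ∈ vertices, ∀ a ∈ [Sum.inl x, Sum.inr (x, false), Sum.inr (x, true)],
      ∀ A ∈ blocks a, scan coreTrie.find A [] = label a := by decide +kernel
  rcases a with x | ⟨x, _ | _⟩ <;> exact key x (mem_vertices x) _ (by simp)

theorem scan_suffixTrie_block (x : V) :
    ∀ A ∈ blocks (Sum.inl x), scan suffixTrie.find A [] = label (Sum.inl x) := by
  have key : ∀ x ∈ vertices, ∀ A ∈ blocks (Sum.inl x),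
      scan suffixTrie.find A [] = label (Sum.inl x) := by decide +kernel
  exact key x (mem_vertices x)

theorem occ_prefixTrie_suffixTrie_apart :
    ∀ e ∈ arcsD, ∀ A ∈ blocks e.1, ∀ B ∈ blocks e.2,
      ∀ p ∈ occ prefixTrie.find 0 (A ++ B), ∀ q ∈ occ suffixTrie.find 0 (A ++ B),
        p + 20 ≤ q ∨ q + 20 ≤ p := by
  decide +kernel

theorem occ_prefixTrie_coreTrie_apart :
    ∀ e ∈ arcsHat, ∀ A ∈ blocks e.1, ∀ B ∈ blocks e.2,
      ∀ p ∈ occ prefixTrie.find 0 (A ++ B), ∀ q ∈ occ coreTrie.find 0 (A ++ B),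
        p + 20 ≤ q ∨ q + 20 ≤ p ∨
        (q = p + 16 ∧ (leftTrie.find ((A ++ B).drop p)).isSome ∧
          (rightTrie.find ((A ++ B).drop (p + 20))).isSome) ∨
        (p = q + 16 ∧ (leftTrie.find ((A ++ B).drop q)).isSome ∧
          (rightTrie.find ((A ++ B).drop (q + 20))).isSome) := by
  decide +kernel

theorem occ_leftTrie_le :
    ∀ x ∈ vertices, ∀ A ∈ blocks (Sum.inl x),
      ∀ k ∈ occ leftTrie.find 0 (A ++ sword x), k + 20 ≤ A.length := by
  decide +kernel

theorem le_occ_rightTrie :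
    ∀ x ∈ vertices, ∀ A ∈ blocks (Sum.inl x),
      ∀ k ∈ occ rightTrie.find 0 (pword x ++ A), (pword x).length + 3 ≤ k := by
  decide +kernel

theorem exists_mem_arcsD (x : V) : ∃ b, (Sum.inl x, b) ∈ arcsD := by
  have key : ∀ x ∈ vertices, x ∈ arcs.map Prod.fst := by decide +kernel
  obtain ⟨⟨_, y⟩, he, rfl⟩ := List.mem_map.1 (key x (mem_vertices x))
  exact ⟨Sum.inl y, List.mem_map.2 ⟨_, he, rfl⟩⟩

end Checks

/-! ### Square-freeness -/

theorem PairFactor.squareFree {E : Vhat → Vhat → Prop} (hE : ∀ a b, E a b → ArcHat a b)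
    {U : List (Fin 3)} (h : PairFactor E U) : SquareFree U := by
  obtain ⟨a, b, hab, A, hA, B, hB, hU⟩ := h
  exact (squareFree_of_noSquare
    (noSquare_of_mem_arcsHat _ (mem_arcsHat (hE a b hab)) A hA B hB)).of_infix hU

theorem exists_arcHat (a : Vhat) : ∃ b, ArcHat a b ∨ ArcHat b a := by
  rcases a with x | ⟨x, _ | _⟩
  · exact ⟨Sum.inr (x, true), Or.inl rfl⟩
  · exact ⟨Sum.inl x, Or.inl rfl⟩
  · exact ⟨Sum.inl x, Or.inr rfl⟩

theorem squareFree_of_mem_blocks {a : Vhat} {A : List (Fin 3)} (hA : A ∈ blocks a) :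
    SquareFree A :=
  (pairFactor_of_infix_block hA (exists_arcHat a) List.infix_rfl).squareFree fun _ _ h => h

/-- The result for walks in `D`. -/
theorem squareFree_of_isChain_arcsD {w : List Vhat} (hw : w.IsChain fun a b => (a, b) ∈ arcsD)
    (hinl : ∀ a ∈ w, ∃ x, a = Sum.inl x) (hsf : SquareFree w) {W : List (Fin 3)}
    (hW : W ∈ SubstSet delta w) : SquareFree W := by
  intro X hX hXX
  have hE : ∀ a b, (a, b) ∈ arcsD → ArcHat a b := fun _ _ => arcHat_of_mem_arcsD
  have hext : ∀ a ∈ w, ∃ b, (a, b) ∈ arcsD ∨ (b, a) ∈ arcsD := by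
    intro a ha
    obtain ⟨x, rfl⟩ := hinl a ha
    obtain ⟨b, hb⟩ := exists_mem_arcsD x
    exact ⟨b, Or.inl hb⟩
  obtain ⟨u, v, h⟩ := exists_straddle isWindow_prefixTrie (by norm_num) hE
    (fun _ => PairFactor.squareFree hE)
    (fun a b hab => scan_prefixTrie_of_mem_arcsHat _ (mem_arcsHat (hE a b hab)))
    (fun a _ => scan_prefixTrie_block a) hext hw hsf hW hX hXX
  obtain ⟨u', v', h'⟩ := exists_straddle isWindow_suffixTrie (by norm_num) hE
    (fun _ => PairFactor.squareFree hE)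
    (fun a b hab => scan_suffixTrie_of_mem_arcsD _ hab)
    (fun a ha => by
      obtain ⟨x, rfl⟩ := hinl a ha
      exact scan_suffixTrie_block x) hext hw hsf hW hX hXX
  obtain ⟨a, b, hab, A, hA, B, hB, p, q, hp, hq, hpq, -⟩ :=
    h.exists_common_pair isWindow_prefixTrie isWindow_suffixTrie (by norm_num) hE hext hw hW hXX h'
  have hapart := occ_prefixTrie_suffixTrie_apart _ hab A hA B hB p hp q hq
  obtain ⟨hu, hv, huv, -⟩ := h
  obtain ⟨hu', hv', huv', -⟩ := h'
  rw [← List.length_pos_iff] at hu hv hu' hv'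
  omega

/-- `X` ends and begins like the two sides of a cut through a short overlap of a prefix and a
central part. -/
def OverlapCut (X : List (Fin 3)) : Prop :=
  (∃ e, e <:+ X ∧ 17 ≤ e.length ∧ e.length ≤ 20 ∧ (leftTrie.find e).isSome) ∧
    ∃ f d, f <+: X ∧ d ≤ 3 ∧ f.length = d + 17 ∧ (rightTrie.find (f.drop d)).isSome

theorem overlapCut_of_drop_eq {X U u v u' v' r r' : List (Fin 3)} {p : ℕ} (hu' : u' ≠ [])
    (hv : v ≠ []) (huv : u.length + v.length = 21) (huv' : u'.length + v'.length = 21)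
    (hlen : u.length = 16 + u'.length) (huX : u <:+ X) (hvX : v' <+: X)
    (hp : U.drop p = u ++ v ++ r) (hq : U.drop (p + 16) = u' ++ v' ++ r')
    (hl : (leftTrie.find (U.drop p)).isSome) (hr : (rightTrie.find (U.drop (p + 20))).isSome) :
    OverlapCut X := by
  rw [← List.length_pos_iff] at hu' hv
  refine ⟨⟨u, huX, by omega, by omega, ?_⟩, v', 4 - u'.length, hvX, by omega, by omega, ?_⟩
  · rw [hp, List.append_assoc, isWindow_leftTrie.append _ _ (by omega)] at hl
    exact hl
  · rw [show p + 20 = p + 16 + 4 from rfl, ← List.drop_drop, hq, List.append_assoc,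
      List.drop_append, List.drop_eq_nil_of_le (by omega), List.nil_append,
      List.drop_append_of_le_length (by omega),
      isWindow_rightTrie.append _ _ (by simp only [List.length_drop]; omega)] at hr
    exact hr

theorem overlapCut_of_square {w : List Vhat} (hw : w.IsChain ArcHat) (hsf : SquareFree w)
    {W X : List (Fin 3)} (hW : W ∈ SubstSet delta w) (hX : X ≠ []) (hXX : X ++ X <:+: W) :
    OverlapCut X := by
  have hE : ∀ a b, ArcHat a b → ArcHat a b := fun _ _ h => h
  have hext : ∀ a ∈ w, ∃ b, ArcHat a b ∨ ArcHat b a := fun a _ => exists_arcHat a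
  obtain ⟨u, v, h⟩ := exists_straddle isWindow_prefixTrie (by norm_num) hE
    (fun _ => PairFactor.squareFree hE)
    (fun a b hab => scan_prefixTrie_of_mem_arcsHat _ (mem_arcsHat hab))
    (fun a _ => scan_prefixTrie_block a) hext hw hsf hW hX hXX
  obtain ⟨u', v', h'⟩ := exists_straddle isWindow_coreTrie (by norm_num) hE
    (fun _ => PairFactor.squareFree hE)
    (fun a b hab => scan_coreTrie_of_mem_arcsHat _ (mem_arcsHat hab))
    (fun a _ => scan_coreTrie_block a) hext hw hsf hW hX hXX
  obtain ⟨a, b, hab, A, hA, B, hB, p, q, hp, hq, hpq, ⟨r, hr⟩, r', hr'⟩ :=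
    h.exists_common_pair isWindow_prefixTrie isWindow_coreTrie (by norm_num) hE hext hw hW hXX h'
  have hapart := occ_prefixTrie_coreTrie_apart _ (mem_arcsHat hab) A hA B hB p hp q hq
  obtain ⟨hu, hv, huv, -, huX, hvX⟩ := h
  obtain ⟨hu', hv', huv', -, huX', hvX'⟩ := h'
  have hu0 := List.length_pos_iff.2 hu
  have hv0 := List.length_pos_iff.2 hv
  have hu0' := List.length_pos_iff.2 hu'
  have hv0' := List.length_pos_iff.2 hv'
  rcases hapart with hc | hc | ⟨rfl, hl, hri⟩ | ⟨rfl, hl, hri⟩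
  · omega
  · omega
  · exact overlapCut_of_drop_eq hu' hv huv huv' (by omega) huX hvX' hr hr' hl hri
  · exact overlapCut_of_drop_eq hu hv' huv' huv (by omega) huX' hvX hr' hr hl hri

/-- A square cannot begin inside the image of an initial letter `p_x`. -/
theorem square_infix_of_pword {x : V} {w : List Vhat}
    (hw : (Sum.inr (x, false) :: w).IsChain ArcHat)
    {W X : List (Fin 3)} (hW : W ∈ SubstSet delta w) (hX : X ≠ []) (hcut : OverlapCut X)
    (hXX : X ++ X <:+: pword x ++ W) : X ++ X <:+: W := by
  obtain ⟨-, f, d, ⟨g, hg⟩, hd, hf, hfind⟩ := hcut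
  obtain ⟨s, t, hst⟩ := hXX
  rw [List.append_assoc, List.append_eq_append_iff] at hst
  rcases hst with ⟨P, hP, h⟩ | ⟨s', -, h⟩
  swap
  · exact ⟨s', t, by simp [h]⟩
  rcases P with _ | ⟨c, P⟩
  · exact ⟨[], t, by simpa using h⟩
  exfalso
  rcases w with _ | ⟨b, w⟩
  · obtain rfl : W = [] := hW
    refine squareFree_of_mem_blocks (a := Sum.inr (x, false)) (A := pword x) (by simp [blocks])
      X hX ⟨s, t, ?_⟩
    rw [hP, List.append_assoc, h, List.append_nil]
  · obtain ⟨A, hA, W', -, rfl⟩ := mem_substSet_cons.1 hW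
    have hb := (List.isChain_cons_cons.1 hw).1
    obtain rfl : b = Sum.inl x := by
      rcases b with y | ⟨y, _ | _⟩ <;> simp_all [ArcHat]
    have hA41 := length_le_of_mem_blocks hA
    obtain ⟨r, hr⟩ : f <+: (c :: P) ++ A := by
      refine List.prefix_of_prefix_length_le (l₃ := (c :: P) ++ (A ++ W')) ?_ ?_ ?_
      · exact ⟨g ++ (X ++ t), by rw [← h, ← hg]; simp⟩
      · exact ⟨W', by simp⟩
      · simp only [List.length_append]
        omega
    have hdrop : (pword x ++ A).drop (s.length + d) = f.drop d ++ r := by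
      rw [← List.drop_drop, hP, List.append_assoc, List.drop_left, ← hr,
        List.drop_append_of_le_length (by omega)]
    have hlen := congrArg List.length hdrop
    simp only [List.length_append, List.length_drop] at hlen
    have hmem := mem_occ (tok := rightTrie.find) 0 (s.length + d) (pword x ++ A)
      (by simp only [List.length_append]; omega)
      (by
        rw [hdrop, isWindow_rightTrie.append _ _ (by simp only [List.length_drop]; omega)]
        exact hfind)
    have hle := le_occ_rightTrie x (mem_vertices x) A hA _ hmem
    have hPlen := congrArg List.length hP
    simp only [List.length_append, List.length_cons] at hPlen
    omega

/-- A square cannot end inside the image of a final letter `s_x`. -/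
theorem square_infix_of_sword {x : V} {w : List Vhat}
    (hw : (w ++ [Sum.inr (x, true)]).IsChain ArcHat)
    {W X : List (Fin 3)} (hW : W ∈ SubstSet delta w) (hX : X ≠ []) (hcut : OverlapCut X)
    (hXX : X ++ X <:+: W ++ sword x) : X ++ X <:+: W := by
  obtain ⟨⟨e, ⟨g, hg⟩, he17, he20, hfind⟩, -⟩ := hcut
  obtain ⟨s, t, hst⟩ := hXX
  rw [List.append_eq_append_iff] at hst
  rcases hst with ⟨t', h, -⟩ | ⟨S, h, hS⟩
  · exact ⟨s, t', h.symm⟩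
  rcases S.eq_nil_or_concat with rfl | ⟨S, c, rfl⟩
  · exact ⟨s, [], by simpa using h⟩
  exfalso
  rcases w.eq_nil_or_concat with rfl | ⟨w, b, rfl⟩
  · obtain rfl : W = [] := hW
    refine squareFree_of_mem_blocks (a := Sum.inr (x, true)) (A := sword x) (by simp [blocks])
      X hX ⟨s, t, ?_⟩
    rw [hS, h, List.nil_append]
  · rw [List.concat_eq_append] at hW hw
    obtain ⟨W', -, A, hA, rfl⟩ := mem_substSet_append.1 hW
    rw [mem_substSet_singleton] at hA
    have hb : ArcHat b (Sum.inr (x, true)) := by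
      rw [List.append_assoc] at hw
      exact (List.isChain_cons_cons.1 (List.isChain_append.1 hw).2.1).1
    obtain rfl : b = Sum.inl x := by
      rcases b with y | ⟨y, _ | _⟩ <;> simp_all [ArcHat]
    have hA41 := length_le_of_mem_blocks hA
    rw [List.concat_eq_append] at h hS
    obtain ⟨r, hr⟩ : e <:+ A ++ (S ++ [c]) := by
      refine List.suffix_of_suffix_length_le (l₃ := W' ++ A ++ (S ++ [c])) ?_ ?_ ?_
      · exact ⟨s ++ (X ++ g), by rw [← h, ← hg]; simp⟩
      · exact ⟨W', by simp⟩
      · simp only [List.length_append]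
        omega
    have hdrop : (A ++ sword x).drop r.length = e ++ t := by
      rw [hS, ← List.append_assoc, ← hr, List.append_assoc, List.drop_left]
    have hlen := congrArg List.length hr
    simp only [List.length_append, List.length_cons, List.length_nil] at hlen
    have hlen' := congrArg List.length hS
    simp only [List.length_append, List.length_cons, List.length_nil] at hlen'
    have hmem := mem_occ (tok := leftTrie.find) 0 r.length (A ++ sword x)
      (by simp only [List.length_append]; omega)
      (by
        rw [hdrop, isWindow_leftTrie.append _ _ he17]
        exact hfind)
    have hle := occ_leftTrie_le x (mem_vertices x) A hA _ hmem
    omega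

/-- A walk in `D̂` begins with some `p_x`, ends with some `s_x`, or is a walk in `D`. -/
theorem isChain_arcHat_cases {w : List Vhat} (hw : w.IsChain ArcHat) :
    (∃ x w', w = Sum.inr (x, false) :: w') ∨ (∃ x w', w = w' ++ [Sum.inr (x, true)]) ∨
      (w.IsChain fun a b => (a, b) ∈ arcsD) ∧ ∀ a ∈ w, ∃ x, a = Sum.inl x := by
  induction w with
  | nil => simp
  | cons a w ih =>
    rcases a with x | ⟨x, _ | _⟩
    · rcases w with _ | ⟨b, w⟩
      · exact Or.inr (Or.inr ⟨List.isChain_singleton _, fun a ha => ⟨x, List.mem_singleton.1 ha⟩⟩)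
      · have hb := List.isChain_cons_cons.1 hw
        rcases ih hb.2 with ⟨y, w', h⟩ | ⟨y, w', h⟩ | ⟨hch, hinl⟩
        · cases h
          exact absurd hb.1 (by simp [ArcHat])
        · exact Or.inr (Or.inl ⟨y, Sum.inl x :: w', by rw [h]; rfl⟩)
        · obtain ⟨y, rfl⟩ := hinl b (by simp)
          refine Or.inr (Or.inr ⟨List.isChain_cons_cons.2
            ⟨List.mem_map.2 ⟨(x, y), hb.1, rfl⟩, hch⟩, ?_⟩)
          intro a ha
          rcases List.mem_cons.1 ha with rfl | ha
          · exact ⟨x, rfl⟩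
          · exact hinl a ha
    · exact Or.inl ⟨x, w, rfl⟩
    · rcases w with _ | ⟨b, w⟩
      · exact Or.inr (Or.inl ⟨x, [], rfl⟩)
      · exact absurd (List.isChain_cons_cons.1 hw).1 (by simp [ArcHat])

/-- Lemma 8: if `w` is a square-free walk in the digraph `D̂`, then every word
in `δ(w)` is square-free. -/
theorem delta_walk_squarefree (w : List Vhat) (hwalk : List.Chain' ArcHat w)
    (hsf : SquareFree w) :
    ∀ W ∈ SubstSet delta w, SquareFree W := by
  induction hn : w.length generalizing w with
  | zero =>
    obtain rfl := List.length_eq_zero_iff.1 hn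
    intro W hW X hX hXX
    obtain rfl : W = [] := hW
    simp_all
  | succ n ih =>
    intro W hW
    rcases isChain_arcHat_cases hwalk with ⟨x, w, rfl⟩ | ⟨x, w, rfl⟩ | ⟨hch, hinl⟩
    · intro X hX hXX
      have hcut := overlapCut_of_square hwalk hsf hW hX hXX
      obtain ⟨A, hA, W', hW', rfl⟩ := mem_substSet_cons.1 hW
      obtain rfl : A = pword x := by simpa [blocks] using hA
      exact ih w hwalk.tail (hsf.of_infix (List.suffix_cons _ _).isInfix) (by simpa using hn) W' hW'
        X hX (square_infix_of_pword hwalk hW' hX hcut hXX)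
    · intro X hX hXX
      have hcut := overlapCut_of_square hwalk hsf hW hX hXX
      obtain ⟨W', hW', A, hA, rfl⟩ := mem_substSet_append.1 hW
      obtain rfl : A = sword x := by simpa [blocks] using mem_substSet_singleton.1 hA
      exact ih w hwalk.left_of_append (hsf.of_infix (List.prefix_append _ _).isInfix)
        (by simpa using hn) W' hW' X hX (square_infix_of_sword hwalk hW' hX hcut hXX)
    · exact squareFree_of_isChain_arcsD hch hinl hsf hW
end

section
/- Let P = abacbcabcbacabacbcabcbabcacbcabcbacabacbcabcbacbc, Q = abacbabcacbacabacbcacbacabcbabcabacbcabcb, R = abacabcacbacabcbabcacbacabacbcacbacabcbabcabacbcabcb, and S = acabacbabcacbacabcbacbcabacbabcacbacabcbabcacbaca, words over Γ = {a, b, c}. Then the concatenations PQ and PR are left extremal square-free, and the concatenations QS and RS are right extremal square-free. -/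
/-- Every square-free extension of `w` is a right extension, and `w` is square-free. -/
def LeftExtremalSquareFree {α : Type*} (w : List α) : Prop :=
  SquareFree w ∧ ∀ v, IsExtension w v → SquareFree v → ∃ a : α, v = w ++ [a]

/-- Every square-free extension of `w` is a left extension, and `w` is square-free. -/
def RightExtremalSquareFree {α : Type*} (w : List α) : Prop :=
  SquareFree w ∧ ∀ v, IsExtension w v → SquareFree v → ∃ a : α, v = a :: w

/-- Whether at some common position the length-`p` prefix of the rest of the first word is also
a prefix of the nonempty rest of the second word. -/
def hasAlignedMatch {α : Type*} [DecidableEq α] (p : ℕ) : List α → List α → Bool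
  | a :: t, b :: s => ((a :: t).take p).isPrefixOf (b :: s) || hasAlignedMatch p t s
  | _, _ => false

/-- Whether `w` contains a factor `x ++ x` with `x` of length `p`, for `0 < p`. -/
def hasSquareOfPeriod {α : Type*} [DecidableEq α] (p : ℕ) (w : List α) : Bool :=
  hasAlignedMatch p w (w.drop p)

/-- Whether `w` contains a factor `x ++ x` with `x` nonempty; short periods are tried first. -/
def hasSquare {α : Type*} [DecidableEq α] (w : List α) : Bool :=
  (List.range (w.length / 2)).any fun k => hasSquareOfPeriod (k + 1) w

/-- Whether inserting any letter in front of position `n` of `w` creates a square; a square of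
period `p` is only looked for within distance `2 * p` of the inserted letter. -/
def insertionsHaveSquare (w : List (Fin 3)) (n : ℕ) : Bool :=
  (List.finRange 3).all fun a => (List.range w.length).any fun k =>
    hasSquareOfPeriod (k + 1)
      ((w.take n).drop (n - 2 * (k + 1)) ++ a :: (w.drop n).take (2 * (k + 1)))

theorem take_prefix_drop_iff {α : Type*} {p : ℕ} (hp : 0 < p) {w : List α} (hw : w ≠ []) :
    w.take p <+: w.drop p ↔ ∃ x : List α, x.length = p ∧ x ++ x <+: w := by
  constructor
  · intro h
    refine ⟨w.take p, ?_, ?_⟩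
    · have hlen := h.length_le
      have hpos := List.length_pos_iff.mpr hw
      simp only [List.length_take, List.length_drop] at hlen ⊢
      omega
    · conv_rhs => rw [← List.take_append_drop p w]
      exact (List.prefix_append_right_inj _).mpr h
  · rintro ⟨x, rfl, y, rfl⟩
    simp [List.append_assoc]

theorem hasSquareOfPeriod_cons {α : Type*} [DecidableEq α] {p : ℕ} (hp : 0 < p) (a : α)
    (t : List α) : hasSquareOfPeriod p (a :: t) =
      (((a :: t).take p).isPrefixOf ((a :: t).drop p) || hasSquareOfPeriod p t) := by
  obtain ⟨q, rfl⟩ := Nat.exists_eq_add_one.mpr hp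
  have htail : t.drop (q + 1) = (t.drop q).tail := by simp
  cases h : t.drop q <;> simp [hasSquareOfPeriod, hasAlignedMatch, htail, h]

theorem hasSquareOfPeriod_iff {α : Type*} [DecidableEq α] {p : ℕ} (hp : 0 < p) (w : List α) :
    hasSquareOfPeriod p w = true ↔ ∃ x : List α, x.length = p ∧ x ++ x <:+: w := by
  induction w with
  | nil =>
    simp only [hasSquareOfPeriod, hasAlignedMatch, Bool.false_eq_true, false_iff, not_exists,
      not_and]
    rintro x rfl h
    simp_all
  | cons a t ih =>
    simp only [hasSquareOfPeriod_cons hp, Bool.or_eq_true, List.isPrefixOf_iff_prefix, ih,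
      take_prefix_drop_iff hp (List.cons_ne_nil a t), List.infix_cons_iff, and_or_left, exists_or]

theorem hasSquare_eq_false_iff {α : Type*} [DecidableEq α] (w : List α) :
    hasSquare w = false ↔ SquareFree w := by
  rw [← not_iff_not, Bool.not_eq_false]
  simp only [hasSquare, List.any_eq_true, List.mem_range, SquareFree, not_forall, not_not,
    hasSquareOfPeriod_iff (Nat.succ_pos _)]
  constructor
  · rintro ⟨k, -, x, hx, h⟩
    exact ⟨x, List.ne_nil_of_length_eq_add_one hx, h⟩
  · rintro ⟨x, hx, h⟩
    have hpos := List.length_pos_iff.mpr hx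
    have hlen := h.length_le
    rw [List.length_append] at hlen
    exact ⟨x.length - 1, by omega, x, by omega, h⟩

theorem not_squareFree_of_insertionsHaveSquare {u v : List (Fin 3)}
    (h : insertionsHaveSquare (u ++ v) u.length = true) (a : Fin 3) :
    ¬ SquareFree (u ++ [a] ++ v) := by
  intro hsf
  obtain ⟨k, -, hk⟩ := List.any_eq_true.mp (List.all_eq_true.mp h a (List.mem_finRange a))
  obtain ⟨x, hx, hxx⟩ := (hasSquareOfPeriod_iff k.succ_pos _).mp hk
  refine hsf x (List.ne_nil_of_length_eq_add_one hx) (hxx.trans ?_)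
  rw [List.take_left, List.drop_left]
  refine ⟨u.take (u.length - 2 * (k + 1)), v.drop (2 * (k + 1)), ?_⟩
  rw [← List.append_assoc, List.take_append_drop]
  simp

theorem leftExtremalSquareFree_of_check {w : List (Fin 3)} (hw : hasSquare w = false)
    (h : (List.range w.length).all (insertionsHaveSquare w) = true) :
    LeftExtremalSquareFree w := by
  refine ⟨(hasSquare_eq_false_iff w).mp hw, ?_⟩
  rintro _ ⟨u, v, a, rfl, rfl⟩ hsf
  rcases eq_or_ne v [] with rfl | hv
  · exact ⟨a, by simp⟩
  · have hpos := List.length_pos_iff.mpr hv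
    exact absurd hsf (not_squareFree_of_insertionsHaveSquare
      (List.all_eq_true.mp h _ (by simpa using hpos)) a)

theorem rightExtremalSquareFree_of_check {w : List (Fin 3)} (hw : hasSquare w = false)
    (h : (List.range w.length).all (fun n => insertionsHaveSquare w (n + 1)) = true) :
    RightExtremalSquareFree w := by
  refine ⟨(hasSquare_eq_false_iff w).mp hw, ?_⟩
  rintro _ ⟨u, v, a, rfl, rfl⟩ hsf
  rcases u with _ | ⟨b, u⟩
  · exact ⟨a, by simp⟩
  · exact absurd hsf (not_squareFree_of_insertionsHaveSquare
      (List.all_eq_true.mp h u.length (by simp)) a)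

/-- The words `PQ` and `PR` are left extremal square-free, and the words `QS` and `RS`
are right extremal square-free. -/
theorem PQ_PR_QS_RS_extremal :
    LeftExtremalSquareFree (Pw ++ Qw) ∧ LeftExtremalSquareFree (Pw ++ Rw) ∧
    RightExtremalSquareFree (Qw ++ Sw) ∧ RightExtremalSquareFree (Rw ++ Sw) := by
  exact ⟨leftExtremalSquareFree_of_check (by decide +kernel) (by decide +kernel),
    leftExtremalSquareFree_of_check (by decide +kernel) (by decide +kernel),
    rightExtremalSquareFree_of_check (by decide +kernel) (by decide +kernel),
    rightExtremalSquareFree_of_check (by decide +kernel) (by decide +kernel)⟩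
end
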